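/- arXiv:math/0610756 — 2 statements merged into one kernel-verified Lean document; each statement's English description precedes it below -/
import Mathlib

section
/- Let γ : ℤ → ℝ be a symmetric function (γ(−k) = γ(k)) and suppose there exist C > 0 and α ∈ (0,1) with γ(k)·k^α → C as k → ∞. Then the block-averaged variance V(m) = (1/m²) ∑_{i=0}^{m−1} ∑_{j=0}^{m−1} γ(i−j) satisfies V(m)·m^α → 2C/((1−α)(2−α)) as m → ∞. In particular V(m) is asymptotically proportional to m^{−α} = m^{2H−2} where H = 1 − α/2, which is the asymptotic relation underlying the aggregated variance estimator of the Hurst parameter. -/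
open Filter Topology Asymptotics in
/-- The increments of `x ↦ x ^ p` along `ℕ` are asymptotic to `p * n ^ (p - 1)`. -/
theorem tendsto_rpow_succ_sub_rpow_mul (p : ℝ) :
    Tendsto (fun k : ℕ => (((k + 1 : ℕ) : ℝ) ^ p - (k : ℝ) ^ p) * (k : ℝ) ^ (1 - p))
      atTop (𝓝 p) := by
  have hd : HasDerivAt (fun x : ℝ => x ^ p) p 1 := by
    simpa using Real.hasDerivAt_rpow_const (x := 1) (p := p) (Or.inl one_ne_zero)
  have hs : Tendsto (fun k : ℕ => ((k : ℝ))⁻¹) atTop (𝓝[≠] 0) := by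
    refine tendsto_nhdsWithin_iff.2 ⟨tendsto_inv_atTop_nhds_zero_nat, ?_⟩
    filter_upwards [eventually_gt_atTop 0] with k hk
    simp [hk.ne']
  refine (hd.tendsto_slope_zero.comp hs).congr' ?_
  filter_upwards [eventually_gt_atTop 0] with k hk
  have hk' : (0 : ℝ) < k := by exact_mod_cast hk
  have h1 : ((k + 1 : ℕ) : ℝ) = k * (1 + (k : ℝ)⁻¹) := by
    push_cast
    field_simp
  have h2 : (k : ℝ) ^ p * (k : ℝ) ^ (1 - p) = k := by
    rw [← Real.rpow_add hk']
    simp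
  rw [h1, Real.mul_rpow hk'.le (by positivity)]
  simp only [Function.comp_apply, inv_inv, smul_eq_mul, Real.one_rpow]
  linear_combination (1 - (1 + (k : ℝ)⁻¹) ^ p) * h2

open Filter Topology Asymptotics in
/-- If `f k ∼ L * k ^ (p - 1)` with `p > 0`, then the partial sums of `f` are asymptotic to
`(L / p) * n ^ p`. -/
theorem tendsto_sum_range_mul_rpow_neg {f : ℕ → ℝ} {p L : ℝ} (hp : 0 < p)
    (hf : Tendsto (fun k : ℕ => f k * (k : ℝ) ^ (1 - p)) atTop (𝓝 L)) :
    Tendsto (fun n : ℕ => (∑ k ∈ Finset.range n, f k) * (n : ℝ) ^ (-p)) atTop (𝓝 (L / p)) := by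
  set g : ℕ → ℝ := fun k => ((k + 1 : ℕ) : ℝ) ^ p - (k : ℝ) ^ p with hg
  have hgpos : ∀ k, 0 < g k := fun k =>
    sub_pos.2 (Real.rpow_lt_rpow (by positivity) (by push_cast; linarith) hp)
  have hgsum : ∀ n, ∑ k ∈ Finset.range n, g k = (n : ℝ) ^ p := fun n => by
    rw [Finset.sum_range_sub (fun k : ℕ => (k : ℝ) ^ p)]
    simp [Real.zero_rpow hp.ne']
  have hratio : Tendsto (fun k => f k / g k) atTop (𝓝 (L / p)) := by
    refine (hf.div (tendsto_rpow_succ_sub_rpow_mul p) hp.ne').congr' ?_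
    filter_upwards [eventually_gt_atTop 0] with k hk
    have hk' : (0 : ℝ) < k := by exact_mod_cast hk
    exact mul_div_mul_right _ _ (Real.rpow_pos_of_pos hk' _).ne'
  have ho : (fun k => f k - L / p * g k) =o[atTop] g := by
    rw [isLittleO_iff_tendsto fun k hk => absurd hk (hgpos k).ne']
    refine (tendsto_sub_nhds_zero_iff.2 hratio).congr fun k => ?_
    have := (hgpos k).ne'
    field_simp
  have htop : Tendsto (fun n => ∑ k ∈ Finset.range n, g k) atTop atTop := by
    simp only [hgsum]
    exact (tendsto_rpow_atTop hp).comp tendsto_natCast_atTop_atTop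
  have hsum := (ho.sum_range (fun k => (hgpos k).le) htop).tendsto_div_nhds_zero
  refine tendsto_sub_nhds_zero_iff.1 (hsum.congr' ?_)
  filter_upwards [eventually_gt_atTop 0] with n hn
  have hn' : (0 : ℝ) < n := by exact_mod_cast hn
  have := (Real.rpow_pos_of_pos hn' p).ne'
  rw [Finset.sum_sub_distrib, ← Finset.mul_sum, hgsum, Real.rpow_neg hn'.le]
  field_simp

/-- The double sum of a symmetric `γ (i - j)` over a square, as a sum of partial sums. -/
theorem sum_range_sum_range_symm_sub {γ : ℤ → ℝ} (hsymm : ∀ k : ℤ, γ (-k) = γ k) (m : ℕ) :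
    ∑ i ∈ Finset.range m, ∑ j ∈ Finset.range m, γ ((i : ℤ) - (j : ℤ)) =
      ∑ n ∈ Finset.range m, (2 * ∑ k ∈ Finset.range n, γ k + 2 * γ n - γ 0) := by
  have hrow (n : ℕ) : ∑ j ∈ Finset.range n, γ ((n : ℤ) - (j : ℤ)) =
      ∑ k ∈ Finset.range n, γ k + γ n - γ 0 := by
    have h := Finset.sum_range_reflect (fun k : ℕ => γ k) (n + 1)
    rw [Finset.sum_range_succ, Finset.sum_range_succ (fun k : ℕ => γ k)] at h
    have h' : ∑ j ∈ Finset.range n, γ ((n : ℤ) - (j : ℤ)) =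
        ∑ j ∈ Finset.range n, γ ((n + 1 - 1 - j : ℕ) : ℤ) :=
      Finset.sum_congr rfl fun j hj => by
        have := Finset.mem_range.1 hj
        congr 1
        omega
    rw [h', ← h]
    simp
  induction m with
  | zero => simp
  | succ n ih =>
    have hcol : ∑ i ∈ Finset.range n, γ ((i : ℤ) - (n : ℤ)) =
        ∑ j ∈ Finset.range n, γ ((n : ℤ) - (j : ℤ)) :=
      Finset.sum_congr rfl fun i _ => by rw [← hsymm, neg_sub]
    simp only [Finset.sum_range_succ _ n, Finset.sum_add_distrib]
    rw [← ih, hcol, hrow, sub_self]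
    ring


/-- If `γ : ℤ → ℝ` is symmetric and `γ(k)·k^α → C` with `C > 0`, `α ∈ (0,1)`,
then the block-averaged variance `V(m) = (1/m²) ∑_{i<m} ∑_{j<m} γ(i−j)` satisfies
`V(m)·m^α → 2C/((1−α)(2−α))` as `m → ∞`. -/
theorem aggregated_variance_asymptotics (γ : ℤ → ℝ)
    (hsymm : ∀ k : ℤ, γ (-k) = γ k) (C α : ℝ) (hC : 0 < C)
    (hα : α ∈ Set.Ioo (0 : ℝ) 1)
    (hlim : Filter.Tendsto (fun k : ℕ => γ (k : ℤ) * (k : ℝ) ^ α)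
      Filter.atTop (nhds C)) :
    Filter.Tendsto
      (fun m : ℕ =>
        ((1 / (m : ℝ) ^ 2) *
          ∑ i ∈ Finset.range m, ∑ j ∈ Finset.range m, γ ((i : ℤ) - (j : ℤ)))
        * (m : ℝ) ^ α)
      Filter.atTop (nhds (2 * C / ((1 - α) * (2 - α)))) := by
  obtain ⟨hα0, hα1⟩ := hα
  have hS := tendsto_sum_range_mul_rpow_neg (f := fun k : ℕ => γ k) (p := 1 - α) (L := C)
    (by linarith) (by simpa using hlim)
  have hinv := tendsto_inv_atTop_nhds_zero_nat (𝕜 := ℝ)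
  have hpow : Filter.Tendsto (fun n : ℕ => (n : ℝ) ^ (-(1 - α))) Filter.atTop (nhds 0) :=
    (tendsto_rpow_neg_atTop (by linarith)).comp tendsto_natCast_atTop_atTop
  have hrow : Filter.Tendsto
      (fun n : ℕ => (2 * ∑ k ∈ Finset.range n, γ k + 2 * γ n - γ 0) * (n : ℝ) ^ (1 - (2 - α)))
      Filter.atTop (nhds (2 * C / (1 - α))) := by
    have h := ((hS.const_mul 2).add ((hlim.mul hinv).const_mul 2)).sub (hpow.const_mul (γ 0))
    rw [show 2 * (C / (1 - α)) + 2 * (C * 0) - γ 0 * 0 = 2 * C / (1 - α) by ring] at h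
    refine h.congr' ?_
    filter_upwards [Filter.eventually_gt_atTop 0] with n hn
    have hn' : (0 : ℝ) < n := by exact_mod_cast hn
    have hexp : (n : ℝ) ^ α * (n : ℝ)⁻¹ = (n : ℝ) ^ (-(1 - α)) := by
      rw [← Real.rpow_neg_one, ← Real.rpow_add hn']
      ring_nf
    rw [show 1 - (2 - α) = -(1 - α) by ring, mul_assoc (γ n), hexp]
    ring
  have hD := tendsto_sum_range_mul_rpow_neg (by linarith) hrow
  rw [div_div] at hD
  refine hD.congr' ?_
  filter_upwards [Filter.eventually_gt_atTop 0] with m hm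
  have hm' : (0 : ℝ) < m := by exact_mod_cast hm
  rw [sum_range_sum_range_symm_sub hsymm, neg_sub, Real.rpow_sub hm', Real.rpow_two]
  ring
end

section
/- Let α ∈ (0,1), C > 0, and let ρ : ℕ → ℝ be nonincreasing with ρ(k) → 0 and ρ(k)·k^α → C as k → ∞. Then for each λ ∈ (0,π) the series f(λ) = ∑_{k=1}^∞ ρ(k) cos(kλ) converges, and λ^{1−α}·f(λ) → C·Γ(1−α)·sin(πα/2) as λ → 0⁺. In particular, f(λ) ∼ C_f·λ^{−β} as λ → 0⁺ with β = 1 − α ∈ (0,1) and C_f = C·Γ(1−α)·sin(πα/2) > 0, which is the frequency-domain characterisation of long-range dependence with Hurst parameter H = (1 + β)/2. -/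
open Real Filter
open Topology Asymptotics

lemma norm_one_sub_mul_sum_Ico_le {f : ℕ → ℝ} (hf : Antitone f) (h0 : ∀ n, 0 ≤ f n)
    {z : ℂ} (hz : ‖z‖ = 1) {N M : ℕ} (h : N ≤ M) :
    ‖(1 - z) * ∑ k ∈ Finset.Ico N M, (f k : ℂ) * z ^ k‖ ≤ 2 * f N := by
  have key : ‖(1 - z) * ∑ k ∈ Finset.Ico N M, (f k : ℂ) * z ^ k + f M * z ^ M‖
      ≤ 2 * f N - f M := by
    induction M, h using Nat.le_induction with
    | base => simp [hz, abs_of_nonneg (h0 N)]; linarith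
    | succ M hM ih =>
      rw [Finset.sum_Ico_succ_top hM]
      have e : (1 - z) * (∑ k ∈ Finset.Ico N M, (f k : ℂ) * z ^ k + f M * z ^ M)
          + f (M + 1) * z ^ (M + 1)
          = ((1 - z) * ∑ k ∈ Finset.Ico N M, (f k : ℂ) * z ^ k + f M * z ^ M)
            - ((f M - f (M + 1) : ℝ) : ℂ) * z ^ (M + 1) := by
        push_cast; ring
      rw [e]
      refine (norm_sub_le _ _).trans ?_
      have : ‖((f M - f (M + 1) : ℝ) : ℂ) * z ^ (M + 1)‖ = f M - f (M + 1) := by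
        rw [norm_mul, norm_pow, hz, one_pow, mul_one, Complex.norm_real, Real.norm_eq_abs,
          abs_of_nonneg (sub_nonneg.2 (hf M.le_succ))]
      linarith
  have h2 : ‖(f M : ℂ) * z ^ M‖ = f M := by simp [hz, abs_of_nonneg (h0 M)]
  have := norm_sub_le ((1 - z) * ∑ k ∈ Finset.Ico N M, (f k : ℂ) * z ^ k + f M * z ^ M)
    ((f M : ℂ) * z ^ M)
  rw [add_sub_cancel_right] at this
  linarith

lemma norm_one_sub_mul_tail_le {f : ℕ → ℝ} (hf : Antitone f) (h0 : ∀ n, 0 ≤ f n)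
    {z S : ℂ} (hz : ‖z‖ = 1)
    (hS : Tendsto (fun n ↦ ∑ k ∈ Finset.range n, (f k : ℂ) * z ^ k) atTop (𝓝 S)) (N : ℕ) :
    ‖(1 - z) * (S - ∑ k ∈ Finset.range N, (f k : ℂ) * z ^ k)‖ ≤ 2 * f N := by
  refine le_of_tendsto ((hS.sub_const _).const_mul (1 - z)).norm ?_
  filter_upwards [eventually_ge_atTop N] with M hM
  rw [← Finset.sum_Ico_eq_sub _ hM]
  exact norm_one_sub_mul_sum_Ico_le hf h0 hz hM

/-- Dirichlet's test for a power series on the unit circle. -/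
lemma exists_tendsto_sum_mul_pow {f : ℕ → ℝ} (hf : Antitone f) (h0 : Tendsto f atTop (𝓝 0))
    {z : ℂ} (hz : ‖z‖ = 1) (hz1 : z ≠ 1) :
    ∃ S, Tendsto (fun n ↦ ∑ k ∈ Finset.range n, (f k : ℂ) * z ^ k) atTop (𝓝 S) := by
  have hb : ∀ n, ‖∑ i ∈ Finset.range n, z ^ i‖ ≤ 2 / ‖z - 1‖ := fun n ↦ by
    rw [geom_sum_eq hz1, norm_div]
    gcongr
    refine (norm_sub_le _ _).trans ?_
    simp [hz]; norm_num
  simpa using cauchySeq_tendsto_of_complete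
    (hf.cauchySeq_series_mul_of_tendsto_zero_of_bounded h0 hb)

lemma two_div_pi_mul_le_norm_one_sub_exp {l : ℝ} (hl : l ∈ Set.Ioo 0 π) :
    2 / π * l ≤ ‖1 - Complex.exp (l * Complex.I)‖ := by
  rw [norm_sub_rev, mul_comm (l : ℂ), Complex.norm_exp_I_mul_ofReal_sub_one]
  have := Real.mul_le_sin (x := l / 2) (by linarith [hl.1]) (by linarith [hl.2])
  rw [Real.norm_eq_abs]
  refine le_trans ?_ (le_abs_self _)
  linarith

lemma exp_ofReal_mul_I_ne_one {l : ℝ} (hl : l ∈ Set.Ioo 0 π) :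
    Complex.exp (l * Complex.I) ≠ 1 := by
  intro h
  have := two_div_pi_mul_le_norm_one_sub_exp hl
  rw [h, sub_self, norm_zero] at this
  have := mul_pos (div_pos two_pos pi_pos) hl.1
  linarith

lemma rpow_neg_isBigO_sub_rpow {α : ℝ} (hα : α ∈ Set.Ioo (0 : ℝ) 1) :
    (fun k : ℕ ↦ (k : ℝ) ^ (-α)) =O[atTop]
      fun k : ℕ ↦ ((k + 1 : ℕ) : ℝ) ^ (1 - α) - (k : ℝ) ^ (1 - α) := by
  obtain ⟨h1, h2⟩ := hα
  refine IsBigO.of_bound (2 ^ α / (1 - α)) ?_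
  filter_upwards [eventually_ge_atTop 1] with k hk
  have hk' : (1 : ℝ) ≤ k := by exact_mod_cast hk
  have hx : (0 : ℝ) < k + 1 := by linarith
  have hb := _root_.rpow_one_add_le_one_add_mul_self (s := -1 / ((k : ℝ) + 1)) (p := 1 - α)
    (by rw [le_div_iff₀ hx]; linarith) (by linarith) (by linarith)
  have e : (k : ℝ) = (k + 1) * (1 + -1 / ((k : ℝ) + 1)) := by field_simp; ring
  have hs : (k : ℝ) ^ (1 - α)
      ≤ (k + 1 : ℝ) ^ (1 - α) - (1 - α) * ((k : ℝ) + 1) ^ (-α) := by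
    have : ((k : ℝ) + 1) ^ (1 - α) = (k + 1) * ((k : ℝ) + 1) ^ (-α) := by
      rw [sub_eq_add_neg, Real.rpow_add hx, Real.rpow_one]
    have h3 : (k : ℝ) ^ (1 - α)
        = (k + 1 : ℝ) ^ (1 - α) * (1 + -1 / ((k : ℝ) + 1)) ^ (1 - α) := by
      conv_lhs => rw [e]
      refine Real.mul_rpow hx.le ?_
      rw [neg_div, ← sub_eq_add_neg, sub_nonneg, div_le_one hx]; linarith
    calc _ ≤ (k + 1 : ℝ) ^ (1 - α) * (1 + (1 - α) * (-1 / ((k : ℝ) + 1))) := by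
            rw [h3]; gcongr
      _ = _ := by rw [this]; field_simp; ring
  have h4 : (k : ℝ) ^ (-α) ≤ 2 ^ α * ((k : ℝ) + 1) ^ (-α) := by
    have : (2 * (k : ℝ)) ^ (-α) ≤ ((k : ℝ) + 1) ^ (-α) :=
      Real.rpow_le_rpow_of_nonpos hx (by linarith) (by linarith)
    rw [Real.mul_rpow two_pos.le (by linarith), Real.rpow_neg two_pos.le] at this
    rwa [← inv_mul_le_iff₀ (by positivity)]
  have h5 : 0 < (k : ℝ) ^ (-α) := by positivity
  have h6 : 0 < ((k : ℝ) + 1) ^ (-α) := by positivity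
  have h1a : 0 < 1 - α := by linarith
  push_cast
  rw [Real.norm_of_nonneg h5.le, Real.norm_of_nonneg (by nlinarith), div_mul_eq_mul_div,
    le_div_iff₀ h1a]
  have : (0 : ℝ) < 2 ^ α := by positivity
  nlinarith

lemma sum_abs_sub_isLittleO {f g : ℕ → ℝ} {α C : ℝ} (hα : α ∈ Set.Ioo (0 : ℝ) 1)
    (hf : Tendsto (fun k : ℕ ↦ f k * (k : ℝ) ^ α) atTop (𝓝 C))
    (hg : Tendsto (fun k : ℕ ↦ g k * (k : ℝ) ^ α) atTop (𝓝 C)) :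
    (fun n ↦ ∑ k ∈ Finset.range n, |f k - g k|) =o[atTop] fun n : ℕ ↦ (n : ℝ) ^ (1 - α) := by
  have hsum : ∀ n : ℕ, ∑ k ∈ Finset.range n,
      (((k + 1 : ℕ) : ℝ) ^ (1 - α) - (k : ℝ) ^ (1 - α)) = (n : ℝ) ^ (1 - α) := fun n ↦ by
    rw [Finset.sum_range_sub (fun k : ℕ ↦ (k : ℝ) ^ (1 - α)), Nat.cast_zero,
      Real.zero_rpow (by linarith [hα.2]), sub_zero]
  have h1 : (fun k ↦ |f k - g k|) =o[atTop] fun k : ℕ ↦ (k : ℝ) ^ (-α) := by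
    refine IsLittleO.abs_left ?_
    rw [isLittleO_iff_tendsto']
    · have := hf.sub hg
      rw [sub_self] at this
      refine this.congr fun k ↦ ?_
      rw [Real.rpow_neg k.cast_nonneg, div_inv_eq_mul, sub_mul]
    · filter_upwards [eventually_gt_atTop 0] with k hk h
      have : 0 < (k : ℝ) ^ (-α) := by positivity
      exact absurd h this.ne'
  have h2 := (h1.trans_isBigO (rpow_neg_isBigO_sub_rpow hα)).sum_range
    (fun k ↦ sub_nonneg.2 (Real.rpow_le_rpow k.cast_nonneg (by push_cast; linarith)
      (by linarith [hα.2])))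
  simp only [hsum] at h2
  exact h2 ((tendsto_rpow_atTop (by linarith [hα.2])).comp tendsto_natCast_atTop_atTop)

lemma norm_sub_le_sum_add {f g : ℕ → ℝ} (hf : Antitone f) (hf0 : ∀ n, 0 ≤ f n)
    (hg : Antitone g) (hg0 : ∀ n, 0 ≤ g n) {l : ℝ} (hl : l ∈ Set.Ioo 0 π) {F G : ℂ}
    (hF : Tendsto (fun n ↦ ∑ k ∈ Finset.range n, (f k : ℂ) * Complex.exp (l * Complex.I) ^ k)
      atTop (𝓝 F))
    (hG : Tendsto (fun n ↦ ∑ k ∈ Finset.range n, (g k : ℂ) * Complex.exp (l * Complex.I) ^ k)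
      atTop (𝓝 G)) (N : ℕ) :
    ‖F - G‖ ≤ ∑ k ∈ Finset.range N, |f k - g k| + π * (f N + g N) / l := by
  have hz := Complex.norm_exp_ofReal_mul_I l
  have hd := two_div_pi_mul_le_norm_one_sub_exp hl
  have hl0 := hl.1
  set z := Complex.exp (l * Complex.I)
  have tail : ∀ {h : ℕ → ℝ} {H : ℂ}, ‖(1 - z) * (H - ∑ k ∈ Finset.range N, (h k : ℂ) * z ^ k)‖
      ≤ 2 * h N → ‖H - ∑ k ∈ Finset.range N, (h k : ℂ) * z ^ k‖ ≤ π * h N / l := by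
    intro h H hH
    rw [norm_mul] at hH
    have h1 := (mul_le_mul_of_nonneg_right hd (norm_nonneg _)).trans hH
    rw [le_div_iff₀ hl0]
    have h2 := mul_le_mul_of_nonneg_left h1 pi_pos.le
    have : π * (2 / π * l * ‖H - ∑ k ∈ Finset.range N, (h k : ℂ) * z ^ k‖)
      = 2 * (‖H - ∑ k ∈ Finset.range N, (h k : ℂ) * z ^ k‖ * l) := by
      field_simp
    linarith
  have tF := tail (norm_one_sub_mul_tail_le hf hf0 hz hF N)
  have tG := tail (norm_one_sub_mul_tail_le hg hg0 hz hG N)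
  have head : ‖∑ k ∈ Finset.range N, (f k : ℂ) * z ^ k - ∑ k ∈ Finset.range N, (g k : ℂ) * z ^ k‖
      ≤ ∑ k ∈ Finset.range N, |f k - g k| := by
    rw [← Finset.sum_sub_distrib]
    refine norm_sum_le_of_le _ fun k _ ↦ ?_
    rw [← sub_mul, norm_mul, norm_pow, hz, one_pow, mul_one, ← Complex.ofReal_sub,
      Complex.norm_real, Real.norm_eq_abs]
  have e : F - G = (∑ k ∈ Finset.range N, (f k : ℂ) * z ^ k
      - ∑ k ∈ Finset.range N, (g k : ℂ) * z ^ k)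
      + (F - ∑ k ∈ Finset.range N, (f k : ℂ) * z ^ k)
      - (G - ∑ k ∈ Finset.range N, (g k : ℂ) * z ^ k) := by ring
  rw [e, mul_add, add_div]
  refine (norm_sub_le _ _).trans ?_
  have := norm_add_le (∑ k ∈ Finset.range N, (f k : ℂ) * z ^ k
      - ∑ k ∈ Finset.range N, (g k : ℂ) * z ^ k) (F - ∑ k ∈ Finset.range N, (f k : ℂ) * z ^ k)
  linarith

/-- The behaviour at `0⁺` of a trigonometric series with monotone coefficients depends only on
the leading power-law asymptotics of the coefficients. -/
lemma tendsto_rpow_mul_sub_zero {f g : ℕ → ℝ} {α C : ℝ} (hα : α ∈ Set.Ioo (0 : ℝ) 1)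
    (hf : Antitone f) (hf0 : ∀ n, 0 ≤ f n) (hg : Antitone g) (hg0 : ∀ n, 0 ≤ g n)
    (hfC : Tendsto (fun k : ℕ ↦ f k * (k : ℝ) ^ α) atTop (𝓝 C))
    (hgC : Tendsto (fun k : ℕ ↦ g k * (k : ℝ) ^ α) atTop (𝓝 C)) {F G : ℝ → ℂ}
    (hF : ∀ l ∈ Set.Ioo 0 π, Tendsto (fun n ↦ ∑ k ∈ Finset.range n,
      (f k : ℂ) * Complex.exp (l * Complex.I) ^ k) atTop (𝓝 (F l)))
    (hG : ∀ l ∈ Set.Ioo 0 π, Tendsto (fun n ↦ ∑ k ∈ Finset.range n,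
      (g k : ℂ) * Complex.exp (l * Complex.I) ^ k) atTop (𝓝 (G l))) :
    Tendsto (fun l : ℝ ↦ ((l ^ (1 - α) : ℝ) : ℂ) * (F l - G l)) (𝓝[>] 0) (𝓝 0) := by
  obtain ⟨hα0, hα1⟩ := hα
  have hC : 0 ≤ C := ge_of_tendsto' hfC fun k ↦ mul_nonneg (hf0 k) (by positivity)
  rw [NormedAddGroup.tendsto_nhds_zero]
  intro ε hε
  set B := 2 * C + 1
  have hB0 : 0 < B := by linarith
  obtain ⟨A, hA1, hA⟩ : ∃ A : ℝ, 1 ≤ A ∧ π * B * A ^ (-α) < ε / 2 := by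
    have h := (tendsto_rpow_neg_atTop hα0).const_mul (π * B)
    rw [mul_zero] at h
    exact ((eventually_ge_atTop 1).and (h.eventually_lt_const (half_pos hε))).exists
  have hA0 : 0 < A := by linarith
  set δ := ε / 2 / (2 * A) ^ (1 - α) with hδ
  have hδ0 : 0 < δ := by positivity
  have hN : Tendsto (fun l : ℝ ↦ ⌈A / l⌉₊) (𝓝[>] 0) atTop := by
    refine tendsto_nat_ceil_atTop.comp ?_
    exact (tendsto_inv_nhdsGT_zero.const_mul_atTop hA0).congr fun l ↦ (div_eq_mul_inv A l).symm
  have hsum := hN.eventually ((sum_abs_sub_isLittleO ⟨hα0, hα1⟩ hfC hgC).def hδ0)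
  have hsumC : Tendsto (fun k : ℕ ↦ (f k + g k) * (k : ℝ) ^ α) atTop (𝓝 (2 * C)) := by
    simpa only [add_mul, two_mul] using hfC.add hgC
  have htail := hN.eventually (hsumC.eventually_lt_const (by linarith : 2 * C < B))
  filter_upwards [hsum, htail, Ioo_mem_nhdsGT pi_pos, Ioo_mem_nhdsGT hA0] with l h1 h2 hl hlA
  have hl0 := hl.1
  have key := norm_sub_le_sum_add hf hf0 hg hg0 hl (hF l hl) (hG l hl) ⌈A / l⌉₊
  set N := ⌈A / l⌉₊
  have hNA : A / l ≤ N := Nat.le_ceil _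
  have hNA' : (N : ℝ) ≤ 2 * A / l := by
    have := (Nat.ceil_lt_add_one (div_pos hA0 hl0).le).le
    have h3 : 1 ≤ A / l := (one_le_div hl0).2 hlA.2.le
    rw [mul_div_assoc]; linarith
  have hN0 : (0 : ℝ) < N := lt_of_lt_of_le (by positivity) hNA
  have hls : 0 < l ^ (1 - α) := by positivity
  have b1 : l ^ (1 - α) * ∑ k ∈ Finset.range N, |f k - g k| ≤ ε / 2 := by
    rw [Real.norm_of_nonneg (Finset.sum_nonneg fun _ _ ↦ abs_nonneg _),
      Real.norm_of_nonneg (by positivity)] at h1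
    calc _ ≤ l ^ (1 - α) * (δ * (2 * A / l) ^ (1 - α)) := by
            gcongr
            refine h1.trans ?_
            gcongr
      _ = ε / 2 := by
            rw [Real.div_rpow (by positivity) hl0.le, hδ]
            field_simp
  have b2 : l ^ (1 - α) * (π * (f N + g N) / l) ≤ π * B * A ^ (-α) := by
    have h3 : f N + g N ≤ B * (A ^ (-α) * l ^ α) := by
      have h4 : f N + g N ≤ B * (N : ℝ) ^ (-α) := by
        rw [Real.rpow_neg hN0.le, ← div_eq_mul_inv, le_div_iff₀ (by positivity)]
        exact h2.le
      refine h4.trans ?_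
      gcongr
      calc (N : ℝ) ^ (-α) ≤ (A / l) ^ (-α) :=
            Real.rpow_le_rpow_of_nonpos (by positivity) hNA (by linarith)
        _ = _ := by
            rw [Real.div_rpow hA0.le hl0.le, Real.rpow_neg hl0.le, div_inv_eq_mul]
    calc _ ≤ l ^ (1 - α) * (π * (B * (A ^ (-α) * l ^ α)) / l) := by gcongr
      _ = π * B * A ^ (-α) * (l ^ (1 - α) * l ^ α / l) := by ring
      _ = _ := by
        rw [← Real.rpow_add hl0, sub_add_cancel, Real.rpow_one, div_self hl0.ne', mul_one]
  rw [norm_mul, Complex.norm_real, Real.norm_of_nonneg hls.le]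
  have := mul_le_mul_of_nonneg_left key hls.le
  rw [mul_add] at this
  linarith

/-- The coefficient of `z ^ n` in the binomial series of `(1 - z) ^ (-s)`. -/
noncomputable def negBinomialCoeff (s : ℝ) (n : ℕ) : ℝ :=
  (∏ j ∈ Finset.range n, (s + j)) / n.factorial

lemma negBinomialCoeff_succ (s : ℝ) (n : ℕ) :
    negBinomialCoeff s (n + 1) = negBinomialCoeff s n * ((s + n) / (n + 1)) := by
  rw [negBinomialCoeff, negBinomialCoeff, Finset.prod_range_succ, Nat.factorial_succ]
  push_cast
  field_simp

lemma negBinomialCoeff_nonneg {s : ℝ} (hs : 0 ≤ s) (n : ℕ) : 0 ≤ negBinomialCoeff s n := by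
  unfold negBinomialCoeff; positivity

lemma antitone_negBinomialCoeff {s : ℝ} (hs : s ∈ Set.Ioo (0 : ℝ) 1) :
    Antitone (negBinomialCoeff s) := by
  refine antitone_nat_of_succ_le fun n ↦ ?_
  rw [negBinomialCoeff_succ]
  refine mul_le_of_le_one_right (negBinomialCoeff_nonneg hs.1.le n) ?_
  rw [div_le_one (by positivity)]
  linarith [hs.2]

lemma ofReal_negBinomialCoeff (s : ℝ) (n : ℕ) :
    (negBinomialCoeff s n : ℂ) = Ring.choose ((s : ℂ) + n - 1) n := by
  have h : (s : ℂ) + n - 1 = ((s + n - 1 : ℝ) : ℂ) := by push_cast; ring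
  rw [h, ← Complex.ofReal_choose, ← Ring.multichoose_eq, Complex.ofReal_inj, negBinomialCoeff,
    div_eq_iff (by positivity)]
  have h1 := Ring.factorial_nsmul_multichoose_eq_ascPochhammer s n
  rw [nsmul_eq_mul, Polynomial.ascPochhammer_smeval_eq_eval] at h1
  rw [mul_comm, h1]
  clear h h1
  induction n with
  | zero => simp
  | succ n ih => rw [Finset.prod_range_succ, ih, ascPochhammer_succ_eval]

lemma tendsto_negBinomialCoeff_mul_rpow {s : ℝ} (hs : 0 < s) :
    Tendsto (fun k : ℕ ↦ negBinomialCoeff s k * (k : ℝ) ^ (1 - s)) atTop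
      (𝓝 (Real.Gamma s)⁻¹) := by
  have h1 : Tendsto (fun k : ℕ ↦ (k : ℝ) / (k + s)) atTop (𝓝 1) :=
    tendsto_natCast_div_add_atTop s
  have h2 := h1.mul ((Real.GammaSeq_tendsto_Gamma s).inv₀ (Real.Gamma_pos_of_pos hs).ne')
  rw [one_mul] at h2
  refine h2.congr' ?_
  filter_upwards [eventually_gt_atTop 0] with k hk
  have hk' : (0 : ℝ) < k := by exact_mod_cast hk
  rw [Real.GammaSeq, negBinomialCoeff, Finset.prod_range_succ, Real.rpow_sub hk', Real.rpow_one]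
  have : (k : ℝ) ^ s ≠ 0 := by positivity
  have : s + k ≠ 0 := by positivity
  have : (k : ℝ) + s ≠ 0 := by positivity
  field_simp
  ring

lemma tendsto_negBinomialCoeff_zero {s : ℝ} (hs : s ∈ Set.Ioo (0 : ℝ) 1) :
    Tendsto (negBinomialCoeff s) atTop (𝓝 0) := by
  have h1 : Tendsto (fun k : ℕ ↦ (k : ℝ) ^ (-(1 - s))) atTop (𝓝 0) :=
    (tendsto_rpow_neg_atTop (by linarith [hs.2])).comp tendsto_natCast_atTop_atTop
  have h2 := (tendsto_negBinomialCoeff_mul_rpow hs.1).mul h1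
  rw [mul_zero] at h2
  refine h2.congr' ?_
  filter_upwards [eventually_gt_atTop 0] with k hk
  have hk' : (0 : ℝ) < k := by exact_mod_cast hk
  rw [mul_assoc, ← Real.rpow_add hk', add_neg_cancel, Real.rpow_zero, mul_one]

lemma hasSum_negBinomialCoeff (s : ℝ) {z : ℂ} (hz : ‖z‖ < 1) :
    HasSum (fun n ↦ (negBinomialCoeff s n : ℂ) * z ^ n) (1 / (1 - z) ^ (s : ℂ)) := by
  have hmem : z ∈ Metric.eball (0 : ℂ) 1 := by
    rw [← ENNReal.ofReal_one, Metric.eball_ofReal]; simpa using hz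
  have := (Complex.one_div_one_sub_cpow_hasFPowerSeriesOnBall_zero (s : ℂ)).hasSum hmem
  simpa [ofReal_negBinomialCoeff, FormalMultilinearSeries.ofScalars_apply_eq, mul_comm] using this

/-- The binomial series of `(1 - z) ^ (-s)` at a point of the unit circle other than `1`. -/
lemma tendsto_sum_negBinomialCoeff {s : ℝ} (hs : s ∈ Set.Ioo (0 : ℝ) 1) {z : ℂ}
    (hz : ‖z‖ = 1) (hz1 : z ≠ 1) :
    Tendsto (fun n ↦ ∑ k ∈ Finset.range n, (negBinomialCoeff s k : ℂ) * z ^ k) atTop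
      (𝓝 (1 / (1 - z) ^ (s : ℂ))) := by
  obtain ⟨S, hS⟩ := exists_tendsto_sum_mul_pow (antitone_negBinomialCoeff hs)
    (tendsto_negBinomialCoeff_zero hs) hz hz1
  have habel := Complex.tendsto_tsum_powerSeries_nhdsWithin_lt hS
  rw [tendsto_map'_iff] at habel
  have hslit : 1 - z ∈ Complex.slitPlane := by
    by_contra h
    rw [Complex.mem_slitPlane_iff, not_or, not_lt, not_not] at h
    obtain ⟨hre, him⟩ := h
    have h1 : z.re ≤ 1 := (Complex.re_le_norm z).trans hz.le
    refine hz1 (Complex.ext ?_ ?_)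
    · simp at hre ⊢; linarith
    · simp at him ⊢; linarith
  have hcont : Tendsto (fun r : ℝ ↦ 1 / (1 - z * r) ^ (s : ℂ)) (𝓝[<] 1)
      (𝓝 (1 / (1 - z) ^ (s : ℂ))) := by
    have h1 : ContinuousAt (fun r : ℝ ↦ 1 - z * (r : ℂ)) 1 := by fun_prop
    have h2 : ContinuousAt (fun r : ℝ ↦ 1 / (1 - z * (r : ℂ)) ^ (s : ℂ)) 1 := by
      refine continuousAt_const.div (h1.cpow continuousAt_const (by simpa using hslit)) ?_
      simpa [Complex.cpow_eq_zero_iff, sub_eq_zero] using fun h ↦ absurd h.symm hz1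
    simpa using h2.tendsto.mono_left nhdsWithin_le_nhds
  have heq : S = 1 / (1 - z) ^ (s : ℂ) := by
    refine tendsto_nhds_unique habel (hcont.congr' ?_)
    filter_upwards [Ioo_mem_nhdsLT (zero_lt_one' ℝ)] with r hr
    have := (hasSum_negBinomialCoeff s (z := z * r) (by
      rw [norm_mul, hz, one_mul, Complex.norm_real, Real.norm_of_nonneg hr.1.le]
      exact hr.2)).tsum_eq
    rw [← this]
    simp [mul_pow, mul_assoc]
  rwa [← heq]

lemma tendsto_rpow_div_one_sub_exp_cpow (s : ℝ) :
    Tendsto (fun l : ℝ ↦ ((l ^ s : ℝ) : ℂ) *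
      (1 / (1 - Complex.exp (l * Complex.I)) ^ (s : ℂ))) (𝓝[>] 0)
      (𝓝 (1 / (-Complex.I) ^ (s : ℂ))) := by
  have hder : HasDerivAt (fun l : ℝ ↦ 1 - Complex.exp (l * Complex.I)) (-Complex.I) 0 := by
    have h1 : HasDerivAt (fun l : ℝ ↦ (l : ℂ) * Complex.I) (1 * Complex.I) 0 :=
      (Complex.ofRealCLM.hasDerivAt (x := (0 : ℝ))).mul_const Complex.I
    simpa using h1.cexp.const_sub 1
  have hq : Tendsto (fun l : ℝ ↦ ((l⁻¹ : ℝ) : ℂ) * (1 - Complex.exp (l * Complex.I))) (𝓝[>] 0)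
      (𝓝 (-Complex.I)) := by
    have := hder.tendsto_slope_zero_right
    simpa using this
  have h2 : Tendsto (fun l : ℝ ↦ 1 /
      (((l⁻¹ : ℝ) : ℂ) * (1 - Complex.exp (l * Complex.I))) ^ (s : ℂ)) (𝓝[>] 0)
      (𝓝 (1 / (-Complex.I) ^ (s : ℂ))) := by
    refine tendsto_const_nhds.div (hq.cpow tendsto_const_nhds (by simp [Complex.mem_slitPlane_iff]))
      (by simp [Complex.cpow_eq_zero_iff])
  refine h2.congr' ?_
  filter_upwards [Ioo_mem_nhdsGT pi_pos] with l hl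
  have hw : 1 - Complex.exp (l * Complex.I) ≠ 0 := sub_ne_zero.2 (exp_ofReal_mul_I_ne_one hl).symm
  have hl0 : (l : ℂ) ≠ 0 := by exact_mod_cast hl.1.ne'
  rw [Complex.ofReal_cpow hl.1.le, one_div, one_div, ← Complex.cpow_neg, ← Complex.cpow_neg,
    Complex.cpow_def_of_ne_zero (mul_ne_zero (by simpa using hl0) hw),
    Complex.cpow_def_of_ne_zero hw, Complex.cpow_def_of_ne_zero hl0, ← Complex.exp_add,
    Complex.log_ofReal_mul (inv_pos.2 hl.1) hw, Real.log_inv, ← Complex.ofReal_log hl.1.le]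
  congr 1
  push_cast
  ring

lemma re_one_div_neg_I_cpow (s : ℝ) :
    (1 / (-Complex.I) ^ (s : ℂ)).re = Real.cos (π * s / 2) := by
  rw [one_div, ← Complex.cpow_neg, Complex.cpow_def_of_ne_zero (by simp), Complex.log_neg_I]
  have : -(π / 2 : ℂ) * Complex.I * -(s : ℂ) = ((π * s / 2 : ℝ) : ℂ) * Complex.I := by
    push_cast; ring
  rw [this, Complex.exp_ofReal_mul_I_re]


/-- If `ρ` is nonincreasing, tends to `0`, and `ρ(k)·k^α → C` with `C > 0`,
`α ∈ (0,1)`, then for every `λ ∈ (0,π)` the series `f(λ) = ∑_{k≥1} ρ(k)cos(kλ)`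
converges, and `λ^{1−α}·f(λ) → C·Γ(1−α)·sin(πα/2)` as `λ → 0⁺`: the spectral
density blows up like `C_f·λ^{−β}` with `β = 1 − α`. -/
theorem spectral_density_power_law (ρ : ℕ → ℝ) (C α : ℝ) (hC : 0 < C)
    (hα : α ∈ Set.Ioo (0 : ℝ) 1) (hmono : Antitone ρ)
    (hzero : Filter.Tendsto ρ Filter.atTop (nhds 0))
    (hlim : Filter.Tendsto (fun k : ℕ => ρ k * (k : ℝ) ^ α)
      Filter.atTop (nhds C)) :
    ∃ f : ℝ → ℝ,
      (∀ l ∈ Set.Ioo (0 : ℝ) π,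
        Filter.Tendsto
          (fun n : ℕ => ∑ k ∈ Finset.Icc 1 n, ρ k * Real.cos ((k : ℝ) * l))
          Filter.atTop (nhds (f l))) ∧
      Filter.Tendsto (fun l : ℝ => l ^ (1 - α) * f l)
        (nhdsWithin 0 (Set.Ioi 0))
        (nhds (C * Real.Gamma (1 - α) * Real.sin (π * α / 2))) := by
  have hs : 1 - α ∈ Set.Ioo (0 : ℝ) 1 := ⟨by linarith [hα.2], by linarith [hα.1]⟩
  have hρ0 : ∀ n, 0 ≤ ρ n := hmono.le_of_tendsto hzero
  have hΓ := Real.Gamma_pos_of_pos hs.1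
  set K := C * Real.Gamma (1 - α)
  have hK0 : 0 < K := mul_pos hC hΓ
  set σ : ℕ → ℝ := fun k ↦ K * negBinomialCoeff (1 - α) k with hσ
  have hσlim : Tendsto (fun k : ℕ ↦ σ k * (k : ℝ) ^ α) atTop (𝓝 C) := by
    have := (tendsto_negBinomialCoeff_mul_rpow hs.1).const_mul K
    rw [sub_sub_cancel, show K * (Real.Gamma (1 - α))⁻¹ = C from
      mul_inv_cancel_right₀ hΓ.ne' C] at this
    exact this.congr fun k ↦ (mul_assoc _ _ _).symm
  have hexists : ∀ l : ℝ, ∃ S, l ∈ Set.Ioo 0 π → Tendsto (fun n ↦ ∑ k ∈ Finset.range n,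
      (ρ k : ℂ) * Complex.exp (l * Complex.I) ^ k) atTop (𝓝 S) := fun l ↦ by
    by_cases hl : l ∈ Set.Ioo 0 π
    · obtain ⟨S, hS⟩ := exists_tendsto_sum_mul_pow hmono hzero
        (Complex.norm_exp_ofReal_mul_I l) (exp_ofReal_mul_I_ne_one hl)
      exact ⟨S, fun _ ↦ hS⟩
    · exact ⟨0, fun h ↦ absurd h hl⟩
  choose F hF using hexists
  have hG : ∀ l ∈ Set.Ioo 0 π, Tendsto (fun n ↦ ∑ k ∈ Finset.range n,
      (σ k : ℂ) * Complex.exp (l * Complex.I) ^ k) atTop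
      (𝓝 (K * (1 / (1 - Complex.exp (l * Complex.I)) ^ ((1 - α : ℝ) : ℂ)))) := fun l hl ↦ by
    have := (tendsto_sum_negBinomialCoeff hs (Complex.norm_exp_ofReal_mul_I l)
      (exp_ofReal_mul_I_ne_one hl)).const_mul (K : ℂ)
    simpa only [hσ, Finset.mul_sum, mul_assoc, Complex.ofReal_mul] using this
  have hcomp := tendsto_rpow_mul_sub_zero hα hmono hρ0
    ((antitone_negBinomialCoeff hs).const_mul hK0.le)
    (fun n ↦ mul_nonneg hK0.le (negBinomialCoeff_nonneg hs.1.le n)) hlim hσlim hF hG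
  have hFlim : Tendsto (fun l : ℝ ↦ ((l ^ (1 - α) : ℝ) : ℂ) * F l) (𝓝[>] 0)
      (𝓝 (K * (1 / (-Complex.I) ^ ((1 - α : ℝ) : ℂ)))) := by
    have := hcomp.add ((tendsto_rpow_div_one_sub_exp_cpow (1 - α)).const_mul (K : ℂ))
    rw [zero_add] at this
    refine this.congr fun l ↦ ?_
    ring
  refine ⟨fun l ↦ (F l).re - ρ 0, fun l hl ↦ ?_, ?_⟩
  · have h1 := ((Complex.continuous_re.tendsto _).comp
      ((hF l hl).comp (tendsto_add_atTop_nat 1))).sub_const (ρ 0)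
    refine h1.congr fun n ↦ ?_
    have hterm : ∀ k : ℕ, ((ρ k : ℂ) * Complex.exp (l * Complex.I) ^ k).re
        = ρ k * Real.cos (k * l) := fun k ↦ by
      rw [Complex.re_ofReal_mul, ← Complex.exp_nat_mul, ← mul_assoc, ← Complex.ofReal_natCast,
        ← Complex.ofReal_mul, Complex.exp_ofReal_mul_I_re]
    simp only [Function.comp_apply, Complex.re_sum, hterm]
    rw [Finset.range_eq_Ico, Finset.sum_eq_sum_Ico_succ_bot n.succ_pos]
    simp [← Finset.Ico_succ_right_eq_Icc]
  · have hre := (Complex.continuous_re.tendsto _).comp hFlim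
    have hpow : Tendsto (fun l : ℝ ↦ l ^ (1 - α) * ρ 0) (𝓝[>] 0) (𝓝 0) := by
      have : ContinuousAt (fun l : ℝ ↦ l ^ (1 - α) * ρ 0) 0 :=
        (Real.continuousAt_rpow_const _ _ (Or.inr hs.1.le)).mul_const _
      simpa [Real.zero_rpow hs.1.ne'] using this.tendsto.mono_left nhdsWithin_le_nhds
    have h := hre.sub hpow
    rw [sub_zero, Complex.re_ofReal_mul, re_one_div_neg_I_cpow,
      show π * (1 - α) / 2 = π / 2 - π * α / 2 by ring, Real.cos_pi_div_two_sub] at h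
    refine h.congr fun l ↦ ?_
    simp only [Function.comp_apply, Complex.re_ofReal_mul]
    ring
end
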